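/- Let H be a finite-dimensional complex vector space, N : H → H a nilpotent linear endomorphism, and k an integer. Then there exists a unique increasing filtration {W_l}_{l∈ℤ} by linear subspaces of H, with W_l = 0 for all sufficiently small l and W_l = H for all sufficiently large l, such that: (1) N(W_l) ⊆ W_{l−2} for every l ∈ ℤ, and (2) for every integer l ≥ 0 the linear map induced by N^l from W_{k+l}/W_{k+l−1} to W_{k−l}/W_{k−l−1} is an isomorphism. -/

import Mathlib

/-- `W` is an increasing filtration of `H` by subspaces, equal to `0` for `l` small enough
and to `H` for `l` large enough, such that `N (W l) ⊆ W (l - 2)` for every `l` and such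
that, for every `l ≥ 0`, the map induced by `N ^ l` from `W (k+l) / W (k+l-1)` to
`W (k-l) / W (k-l-1)` is an isomorphism (expressed here by saying that the induced map is
injective and surjective, without constructing the quotients). -/
def IsWeightFiltration {H : Type*} [AddCommGroup H] [Module ℂ H]
    (N : Module.End ℂ H) (k : ℤ) (W : ℤ → Submodule ℂ H) : Prop :=
  Monotone W ∧
  (∃ a : ℤ, ∀ l ≤ a, W l = ⊥) ∧
  (∃ b : ℤ, ∀ l, b ≤ l → W l = ⊤) ∧
  (∀ l : ℤ, (W l).map N ≤ W (l - 2)) ∧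
  (∀ l : ℕ,
    (∀ y ∈ W (k + l), (N ^ l) y ∈ W (k - l - 1) → y ∈ W (k + l - 1)) ∧
    (∀ x ∈ W (k - l), ∃ y ∈ W (k + l), (N ^ l) y - x ∈ W (k - l - 1)))

namespace WeightFiltration

section Module

variable {R M : Type*} [Semiring R] [AddCommMonoid M] [Module R M]

/-- The part of non-negative index of the centred weight filtration of `N`, where `N ^ n = 0`:
it is everything from index `n` on, and is determined below `n` by descending recursion. -/
def upper (N : Module.End R M) (n m : ℕ) : Submodule R M :=
  if m < n then ((upper N n (m + 2)).map (N ^ (m + 2))).comap (N ^ (m + 1)) else ⊤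
termination_by n - m

variable {N : Module.End R M} {n : ℕ}

theorem upper_of_le {m : ℕ} (h : n ≤ m) : upper N n m = ⊤ := by
  rw [upper, if_neg (by omega)]

theorem comap_pow_eq_top (hn : N ^ n = 0) {m : ℕ} (h : n ≤ m) (p : Submodule R M) :
    p.comap (N ^ m) = ⊤ := by
  rw [pow_eq_zero_of_le h hn, Submodule.comap_zero]

theorem upper_eq_comap (hn : N ^ n = 0) (m : ℕ) :
    upper N n m = ((upper N n (m + 2)).map (N ^ (m + 2))).comap (N ^ (m + 1)) := by
  by_cases h : m < n
  · rw [upper, if_pos h]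
  · rw [upper_of_le (by omega), comap_pow_eq_top hn (by omega)]

theorem mem_upper (hn : N ^ n = 0) {m : ℕ} {y : M} :
    y ∈ upper N n m ↔ ∃ z ∈ upper N n (m + 2), (N ^ (m + 2)) z = (N ^ (m + 1)) y := by
  rw [upper_eq_comap hn, Submodule.mem_comap, Submodule.mem_map]

theorem upper_le_succ (hn : N ^ n = 0) (m : ℕ) : upper N n m ≤ upper N n (m + 1) := by
  by_cases h : m < n
  · intro y hy
    obtain ⟨z, hz, hzy⟩ := (mem_upper hn).1 hy
    refine (mem_upper hn).2 ⟨z, upper_le_succ hn (m + 2) hz, ?_⟩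
    rw [pow_succ' N (m + 2), Module.End.mul_apply, hzy, pow_succ' N (m + 1), Module.End.mul_apply]
  · rw [upper_of_le (m := m + 1) (by omega)]
    exact le_top
termination_by n - m

/-- The weight filtration of `N` with central index `k`, where `N ^ n = 0`. -/
def filtration (N : Module.End R M) (n : ℕ) (k i : ℤ) : Submodule R M :=
  (upper N n (i - k).natAbs).map (N ^ (k - i).toNat)

theorem filtration_of_eq_add {k i : ℤ} (m : ℕ) (h : i = k + m) :
    filtration N n k i = upper N n m := by
  rw [filtration, show (i - k).natAbs = m by omega, show (k - i).toNat = 0 by omega, pow_zero,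
    Module.End.one_eq_id, Submodule.map_id]

theorem filtration_of_eq_sub {k i : ℤ} (m : ℕ) (h : i = k - m) :
    filtration N n k i = (upper N n m).map (N ^ m) := by
  rw [filtration, show (i - k).natAbs = m by omega, show (k - i).toNat = m by omega]

theorem filtration_monotone (hn : N ^ n = 0) (k : ℤ) : Monotone (filtration N n k) := by
  refine monotone_int_of_le_succ fun i => ?_
  rcases le_or_gt k i with h | h
  · obtain ⟨m, hm⟩ := Int.eq_ofNat_of_zero_le (sub_nonneg.2 h)
    rw [filtration_of_eq_add m (by omega), filtration_of_eq_add (m + 1) (by omega)]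
    exact upper_le_succ hn m
  · obtain ⟨m, hm⟩ := Int.eq_ofNat_of_zero_le (show 0 ≤ k - i - 1 by omega)
    rw [filtration_of_eq_sub (m + 1) (by omega), filtration_of_eq_sub m (by omega)]
    rintro _ ⟨y, hy, rfl⟩
    refine ⟨N y, (mem_upper hn).2 ⟨y, upper_le_succ hn _ hy, ?_⟩, ?_⟩
    · rw [pow_succ N (m + 1), Module.End.mul_apply]
    · rw [pow_succ N m, Module.End.mul_apply]

theorem map_filtration_le (hn : N ^ n = 0) (k i : ℤ) :
    (filtration N n k i).map N ≤ filtration N n k (i - 2) := by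
  rcases lt_or_ge k i with h | h
  · obtain ⟨m, hm⟩ := Int.eq_ofNat_of_zero_le (show 0 ≤ i - k - 1 by omega)
    rw [filtration_of_eq_add (m + 1) (by omega)]
    rcases m with _ | m
    · rw [filtration_of_eq_sub 1 (by omega), pow_one]
    · rw [filtration_of_eq_add m (by omega)]
      rintro _ ⟨y, hy, rfl⟩
      exact (mem_upper hn).2 ⟨y, hy, by rw [pow_succ N (m + 1), Module.End.mul_apply]⟩
  · obtain ⟨m, hm⟩ := Int.eq_ofNat_of_zero_le (show 0 ≤ k - i by omega)
    rw [filtration_of_eq_sub m (by omega), filtration_of_eq_sub (m + 2) (by omega)]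
    rintro _ ⟨_, ⟨y, hy, rfl⟩, rfl⟩
    obtain ⟨z, hz, hzy⟩ := (mem_upper hn).1 hy
    exact ⟨z, hz, by rw [hzy, pow_succ' N m, Module.End.mul_apply]⟩

end Module

variable {H : Type*} [AddCommGroup H] [Module ℂ H] {N : Module.End ℂ H} {n : ℕ} {k : ℤ}
  {W : ℤ → Submodule ℂ H}

theorem isWeightFiltration_filtration (hn : N ^ n = 0) (k : ℤ) :
    IsWeightFiltration N k (filtration N n k) := by
  refine ⟨filtration_monotone hn k, ⟨k - n, fun l hl => ?_⟩, ⟨k + n, fun l hl => ?_⟩,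
    map_filtration_le hn k, fun l => ⟨fun y hy hNy => ?_, fun x hx => ?_⟩⟩
  · rw [filtration, pow_eq_zero_of_le (by omega) hn, Submodule.map_zero]
  · rw [filtration, upper_of_le (by omega), show (k - l).toNat = 0 by omega, pow_zero,
      Module.End.one_eq_id, Submodule.map_id]
  · rcases l with _ | l
    · simpa using hNy
    · rw [filtration_of_eq_sub (l + 2) (by omega)] at hNy
      rwa [filtration_of_eq_add l (by omega), upper_eq_comap hn]
  · rw [filtration_of_eq_sub l rfl] at hx
    obtain ⟨y, hy, rfl⟩ := hx
    exact ⟨y, by rwa [filtration_of_eq_add l rfl], by simp⟩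

theorem pow_apply_mem (hW : IsWeightFiltration N k W) (j : ℕ) {i : ℤ} {y : H} (hy : y ∈ W i) :
    (N ^ j) y ∈ W (i - 2 * j) := by
  induction j with
  | zero => simpa using hy
  | succ j ih =>
    have := hW.2.2.2.1 _ (Submodule.mem_map_of_mem ih)
    rw [pow_succ', Module.End.mul_apply]
    convert this using 2
    push_cast
    ring

theorem eq_map_pow (hW : IsWeightFiltration N k W) (l : ℕ) :
    W (k - l) = (W (k + l)).map (N ^ l) := by
  apply le_antisymm
  · obtain ⟨a, ha⟩ := hW.2.1
    suffices ∀ d l : ℕ, k - l ≤ a + d → W (k - l) ≤ (W (k + l)).map (N ^ l) from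
      this (k - l - a).toNat l (by omega)
    intro d
    induction d with
    | zero => intro l hl; rw [ha _ (by simpa using hl)]; exact bot_le
    | succ d ih =>
      intro l hl x hx
      obtain ⟨y, hy, hyx⟩ := (hW.2.2.2.2 l).2 x hx
      have hstep := ih (l + 1) (by push_cast at hl ⊢; omega)
      obtain ⟨z, hz, hzy⟩ := hstep (show (N ^ l) y - x ∈ W (k - ↑(l + 1)) by
        convert hyx using 2; push_cast; ring)
      have hNz : N z ∈ W (k + l) := hW.1 (by push_cast; omega)
        (hW.2.2.2.1 _ (Submodule.mem_map_of_mem hz))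
      refine ⟨y - N z, sub_mem hy hNz, ?_⟩
      rw [map_sub, ← Module.End.mul_apply, ← pow_succ, hzy, sub_sub_cancel]
  · rintro _ ⟨y, hy, rfl⟩
    convert pow_apply_mem hW l hy using 2
    ring

theorem eq_comap_pow (hW : IsWeightFiltration N k W) (m : ℕ) :
    W (k + m) = (W (k - (m + 2 : ℕ))).comap (N ^ (m + 1)) := by
  apply le_antisymm
  · intro y hy
    rw [Submodule.mem_comap]
    convert pow_apply_mem hW (m + 1) hy using 2
    push_cast
    ring
  · intro y hy
    obtain ⟨b, hb⟩ := hW.2.2.1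
    suffices ∀ d : ℕ, y ∈ W (k + m + d) → y ∈ W (k + m) from
      this (b - (k + m)).toNat (by rw [hb _ (by omega)]; trivial)
    intro d
    induction d with
    | zero => simp
    | succ d ih =>
      intro hd
      refine ih ?_
      have hinj := (hW.2.2.2.2 (m + 1 + d)).1 y
      have hy' := pow_apply_mem hW d (Submodule.mem_comap.1 hy)
      rw [← Module.End.mul_apply, ← pow_add, add_comm d] at hy'
      have := hinj (by convert hd using 2; push_cast; ring)
        (hW.1 (by push_cast; omega) hy')
      convert this using 2
      push_cast
      ring

theorem eq_upper (hn : N ^ n = 0) (hW : IsWeightFiltration N k W) (m : ℕ) :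
    W (k + m) = upper N n m := by
  by_cases h : m < n
  · rw [eq_comap_pow hW, eq_map_pow hW, eq_upper hn hW (m + 2), ← upper_eq_comap hn]
  · rw [eq_comap_pow hW, comap_pow_eq_top hn (by omega), upper_of_le (by omega)]
termination_by n - m

theorem eq_filtration (hn : N ^ n = 0) (hW : IsWeightFiltration N k W) :
    W = filtration N n k := by
  funext i
  rcases le_or_gt k i with h | h
  · obtain ⟨m, rfl⟩ := Int.le.dest h
    rw [filtration_of_eq_add m rfl, eq_upper hn hW]
  · obtain ⟨m, hm⟩ := Int.le.dest h.le
    obtain rfl : i = k - m := by omega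
    rw [filtration_of_eq_sub m rfl, eq_map_pow hW, eq_upper hn hW]

end WeightFiltration

/-- Let `H` be a finite-dimensional complex vector space,
`N : H → H` a nilpotent endomorphism and `k` an integer.  Then there is a unique
increasing filtration `{W_l}` of `H` as above: the weight filtration of `N` with
central index `k`. -/
theorem stmt_8 (H : Type*) [AddCommGroup H] [Module ℂ H] [FiniteDimensional ℂ H]
    (N : Module.End ℂ H) (hN : IsNilpotent N) (k : ℤ) :
    ∃! W : ℤ → Submodule ℂ H, IsWeightFiltration N k W := by
  obtain ⟨n, hn⟩ := hN
  exact ⟨WeightFiltration.filtration N n k,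
    WeightFiltration.isWeightFiltration_filtration hn k,
    fun _ hW => WeightFiltration.eq_filtration hn hW⟩
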